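/- arXiv:2306.06374 — 4 statements merged into one kernel-verified Lean document; each statement's English description precedes it below -/
import Mathlib

section
/- Let G be a group and let ρ, R, h and A₁¹, A₁², A₂², (A₁¹)′, (A₁ⁿ)′, B₁¹, B₁², B₂², C₀¹, C₀², C₀³, C₁², C₂² be elements of G satisfying the conjugation relations: ρA₁¹ρ⁻¹ = (A₁¹)′, ρA₁²ρ⁻¹ = (A₁ⁿ)′, h(A₁¹)′h⁻¹ = A₁², h(A₁ⁿ)′h⁻¹ = (A₁ⁿ)′, hA₁²h⁻¹ = A₂², hB₁¹h⁻¹ = B₁², hB₁²h⁻¹ = B₂², hC₀¹h⁻¹ = C₁², hC₀³h⁻¹ = C₀², hC₁²h⁻¹ = C₂², RC₀¹R⁻¹ = C₀², and RC₀²R⁻¹ = C₀³. Then the subgroup of G generated by ρ, R, h, A₁¹(A₁²)⁻¹, B₁¹(B₁²)⁻¹ and C₀¹(C₀²)⁻¹ contains the elements A₁²(A₂²)⁻¹, B₁²(B₂²)⁻¹ and C₁²(C₂²)⁻¹. -/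
/-- Conjugating by an element of a subgroup preserves lying in the same right coset. -/
theorem Subgroup.mul_inv_mem_of_conj {G : Type*} [Group G] {H : Subgroup G}
    {f x y x' y' : G} (hf : f ∈ H) (hx : f * x * f⁻¹ = x') (hy : f * y * f⁻¹ = y')
    (hxy : x * y⁻¹ ∈ H) : x' * y'⁻¹ ∈ H := by
  have key : x' * y'⁻¹ = f * (x * y⁻¹) * f⁻¹ := by
    rw [← hx, ← hy]
    group
  rw [key]
  exact H.mul_mem (H.mul_mem hf hxy) (H.inv_mem hf)

/-- Two elements in the same right coset as a third one are in the same right coset. -/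
theorem Subgroup.mul_inv_mem_of_common {G : Type*} [Group G] {H : Subgroup G}
    {x y z : G} (hxz : x * z⁻¹ ∈ H) (hyz : y * z⁻¹ ∈ H) : x * y⁻¹ ∈ H := by
  simpa [mul_assoc] using H.mul_mem hxz (H.inv_mem hyz)

/-- Abstract form of Lemma 2 of the paper, case `n = 3`. -/
theorem lemma2_case_n_eq_three {G : Type*} [Group G]
    (ρ R h A11 A12 A22 A11p A1np B11 B12 B22 C01 C02 C03 C12 C22 : G)
    (h1 : ρ * A11 * ρ⁻¹ = A11p)
    (h2 : ρ * A12 * ρ⁻¹ = A1np)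
    (h3 : h * A11p * h⁻¹ = A12)
    (h4 : h * A1np * h⁻¹ = A1np)
    (h5 : h * A12 * h⁻¹ = A22)
    (h6 : h * B11 * h⁻¹ = B12)
    (h7 : h * B12 * h⁻¹ = B22)
    (h8 : h * C01 * h⁻¹ = C12)
    (h9 : h * C03 * h⁻¹ = C02)
    (h10 : h * C12 * h⁻¹ = C22)
    (h11 : R * C01 * R⁻¹ = C02)
    (h12 : R * C02 * R⁻¹ = C03) :
    A12 * (A22)⁻¹ ∈ Subgroup.closure
        ({ρ, R, h, A11 * (A12)⁻¹, B11 * (B12)⁻¹, C01 * (C02)⁻¹} : Set G) ∧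
    B12 * (B22)⁻¹ ∈ Subgroup.closure
        ({ρ, R, h, A11 * (A12)⁻¹, B11 * (B12)⁻¹, C01 * (C02)⁻¹} : Set G) ∧
    C12 * (C22)⁻¹ ∈ Subgroup.closure
        ({ρ, R, h, A11 * (A12)⁻¹, B11 * (B12)⁻¹, C01 * (C02)⁻¹} : Set G) := by
  set H := Subgroup.closure
    ({ρ, R, h, A11 * (A12)⁻¹, B11 * (B12)⁻¹, C01 * (C02)⁻¹} : Set G)
  have hρ : ρ ∈ H := Subgroup.subset_closure (by simp)
  have hR : R ∈ H := Subgroup.subset_closure (by simp)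
  have hh : h ∈ H := Subgroup.subset_closure (by simp)
  have hA : A11 * A12⁻¹ ∈ H := Subgroup.subset_closure (by simp)
  have hB : B11 * B12⁻¹ ∈ H := Subgroup.subset_closure (by simp)
  have hC : C01 * C02⁻¹ ∈ H := Subgroup.subset_closure (by simp)
  refine ⟨?_, Subgroup.mul_inv_mem_of_conj hh h6 h7 hB, ?_⟩
  · have hA12 : A12 * A1np⁻¹ ∈ H :=
      Subgroup.mul_inv_mem_of_conj hh h3 h4 (Subgroup.mul_inv_mem_of_conj hρ h1 h2 hA)
    exact Subgroup.mul_inv_mem_of_common hA12 (Subgroup.mul_inv_mem_of_conj hh h5 h4 hA12)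
  · have hC03 : C01 * C03⁻¹ ∈ H := by
      simpa [mul_assoc] using H.mul_mem hC (Subgroup.mul_inv_mem_of_conj hR h11 h12 hC)
    have hC12 : C12 * C02⁻¹ ∈ H := Subgroup.mul_inv_mem_of_conj hh h8 h9 hC03
    exact Subgroup.mul_inv_mem_of_conj hh h8 h10 (Subgroup.mul_inv_mem_of_common hC hC12)
end

section
/- Let G be a group and let R, A₁, A₂, A₂′, A₃′, B₁, B₂, B₃, C₁, C₂ ∈ G. Set L₁ = B₁C₁C₂⁻¹B₃⁻¹, L₂ = A₁(A₂′)⁻¹, L₃ = L₁⁻¹ and L₆ = A₃′A₂⁻¹. Assume: (i) RA₁R⁻¹ = A₂, RA₂′R⁻¹ = A₃′, RB₁R⁻¹ = B₂, RB₂R⁻¹ = B₃, RC₁R⁻¹ = C₂; (ii) (L₂L₁)A₁(L₂L₁)⁻¹ = B₁ and (L₂L₁)A₂′(L₂L₁)⁻¹ = A₂′; (iii) L₁B₁L₁⁻¹ = C₁ and L₁A₂′L₁⁻¹ = A₂′; (iv) (L₆L₃)A₃′(L₆L₃)⁻¹ = B₃ and (L₆L₃)A₂(L₆L₃)⁻¹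 = A₂. Then the subgroup of G generated by R, L₁ and L₂ contains the elements A₁A₂⁻¹, B₁B₂⁻¹ and C₁C₂⁻¹. -/
/-- If `H` contains `g` and `x * y⁻¹`, it contains the quotient of the conjugates of `x` and `y`
by `g`. -/
theorem Subgroup.conj_mul_inv_mem {G : Type*} [Group G] {H : Subgroup G} {g x y x' y' : G}
    (hg : g ∈ H) (hxy : x * y⁻¹ ∈ H) (hx : g * x * g⁻¹ = x') (hy : g * y * g⁻¹ = y') :
    x' * y'⁻¹ ∈ H := by
  subst hx hy
  simpa [mul_assoc] using H.mul_mem (H.mul_mem hg hxy) (H.inv_mem hg)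

theorem Subgroup.mul_inv_mem_symm {G : Type*} [Group G] {H : Subgroup G} {x y : G}
    (h : x * y⁻¹ ∈ H) : y * x⁻¹ ∈ H := by
  simpa using H.inv_mem h

theorem Subgroup.mul_inv_mem_trans {G : Type*} [Group G] {H : Subgroup G} {x y z : G}
    (hxy : x * y⁻¹ ∈ H) (hyz : y * z⁻¹ ∈ H) : x * z⁻¹ ∈ H := by
  simpa [mul_assoc] using H.mul_mem hxy hyz

/-- Abstract group-theoretic form of Lemma 6 of the paper (valid for `n ≥ 3`). -/
theorem lemma6_abstract {G : Type*} [Group G]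
    (R A₁ A₂ A₂' A₃' B₁ B₂ B₃ C₁ C₂ L₁ L₂ L₃ L₆ : G)
    (hL₁ : L₁ = B₁ * C₁ * C₂⁻¹ * B₃⁻¹)
    (hL₂ : L₂ = A₁ * A₂'⁻¹)
    (hL₃ : L₃ = L₁⁻¹)
    (hL₆ : L₆ = A₃' * A₂⁻¹)
    (hRA₁ : R * A₁ * R⁻¹ = A₂)
    (hRA₂' : R * A₂' * R⁻¹ = A₃')
    (hRB₁ : R * B₁ * R⁻¹ = B₂)
    (hRB₂ : R * B₂ * R⁻¹ = B₃)
    (hRC₁ : R * C₁ * R⁻¹ = C₂)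
    (h21A : (L₂ * L₁) * A₁ * (L₂ * L₁)⁻¹ = B₁)
    (h21A' : (L₂ * L₁) * A₂' * (L₂ * L₁)⁻¹ = A₂')
    (h1B : L₁ * B₁ * L₁⁻¹ = C₁)
    (h1A' : L₁ * A₂' * L₁⁻¹ = A₂')
    (h63A : (L₆ * L₃) * A₃' * (L₆ * L₃)⁻¹ = B₃)
    (h63A₂ : (L₆ * L₃) * A₂ * (L₆ * L₃)⁻¹ = A₂) :
    A₁ * A₂⁻¹ ∈ Subgroup.closure ({R, L₁, L₂} : Set G) ∧
    B₁ * B₂⁻¹ ∈ Subgroup.closure ({R, L₁, L₂} : Set G) ∧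
    C₁ * C₂⁻¹ ∈ Subgroup.closure ({R, L₁, L₂} : Set G) := by
  set H := Subgroup.closure ({R, L₁, L₂} : Set G)
  have hR : R ∈ H := Subgroup.subset_closure (by simp)
  have h₁ : L₁ ∈ H := Subgroup.subset_closure (by simp)
  have h₂ : L₂ ∈ H := Subgroup.subset_closure (by simp)
  have hA₁A₂' : A₁ * A₂'⁻¹ ∈ H := hL₂ ▸ h₂
  have hB₁A₂' : B₁ * A₂'⁻¹ ∈ H :=
    Subgroup.conj_mul_inv_mem (H.mul_mem h₂ h₁) hA₁A₂' h21A h21A'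
  have hC₁A₂' : C₁ * A₂'⁻¹ ∈ H := Subgroup.conj_mul_inv_mem h₁ hB₁A₂' h1B h1A'
  have hA₃'A₂ : A₃' * A₂⁻¹ ∈ H :=
    Subgroup.mul_inv_mem_symm (Subgroup.conj_mul_inv_mem hR hA₁A₂' hRA₁ hRA₂')
  have hB₃A₂ : B₃ * A₂⁻¹ ∈ H :=
    Subgroup.conj_mul_inv_mem (H.mul_mem (hL₆ ▸ hA₃'A₂) (hL₃ ▸ H.inv_mem h₁)) hA₃'A₂ h63A h63A₂
  have hA₁B₁ : A₁ * B₁⁻¹ ∈ H :=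
    Subgroup.mul_inv_mem_trans hA₁A₂' (Subgroup.mul_inv_mem_symm hB₁A₂')
  have hA₂B₂ : A₂ * B₂⁻¹ ∈ H := Subgroup.conj_mul_inv_mem hR hA₁B₁ hRA₁ hRB₁
  have hB₂B₃ : B₂ * B₃⁻¹ ∈ H :=
    Subgroup.mul_inv_mem_symm (Subgroup.mul_inv_mem_trans hB₃A₂ hA₂B₂)
  have hB₁B₂ : B₁ * B₂⁻¹ ∈ H :=
    Subgroup.conj_mul_inv_mem (H.inv_mem hR) hB₂B₃
      (by rw [← hRB₁]; group) (by rw [← hRB₂]; group)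
  have hC₁B₁ : C₁ * B₁⁻¹ ∈ H :=
    Subgroup.mul_inv_mem_trans hC₁A₂' (Subgroup.mul_inv_mem_symm hB₁A₂')
  have hC₂B₂ : C₂ * B₂⁻¹ ∈ H := Subgroup.conj_mul_inv_mem hR hC₁B₁ hRC₁ hRB₁
  exact ⟨Subgroup.mul_inv_mem_trans (Subgroup.mul_inv_mem_trans hA₁B₁ hB₁B₂)
      (Subgroup.mul_inv_mem_symm hA₂B₂), hB₁B₂,
    Subgroup.mul_inv_mem_trans (Subgroup.mul_inv_mem_trans hC₁B₁ hB₁B₂)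
      (Subgroup.mul_inv_mem_symm hC₂B₂)⟩
end

section
/- Let G be a group and let h, A₁, A₂, A₃, B₁, B₂, B₃, C₁, C₂, D₁, D₂ ∈ G. Set g₁ = (A₁A₂⁻¹)(B₁B₂⁻¹), g₂ = (B₁B₂⁻¹)(C₁C₂⁻¹), g₃ = (B₂A₁⁻¹)(C₁A₁⁻¹)(A₁A₂⁻¹)(C₂A₁⁻¹) and g₄ = (B₃A₁⁻¹)(C₂A₁⁻¹)(A₃A₁⁻¹)(B₃A₁⁻¹). Assume: (i) hA₁h⁻¹ = A₂, hA₂h⁻¹ = A₃, hB₁h⁻¹ = B₂, hB₂h⁻¹ = B₃; (ii) g₁A₁g₁⁻¹ = B₁ and g₁A₃g₁⁻¹ = A₃; (iii) g₂B₁g₂⁻¹ = C₁ and g₂A₃g₂⁻¹ = A₃; (iv) g₃B₂g₃⁻¹ = D₁ and g₃A₁g₃⁻¹ = A₁; (v) g₄D₁g₄⁻¹ = D₂ and g₄A₁g₄⁻¹ = A₁; (vi) each of A₁, C₁, C₂, A₃ commutes with each of A₂, D₁, D₂ and each two of A₁, C₁, C₂, A₃ commute with each other; (vii) A₁C₁C₂A₃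 = A₂D₁D₂. Then the subgroup of G generated by h, A₁A₂⁻¹, B₁B₂⁻¹ and C₁C₂⁻¹ contains the elements A₁, A₂, A₃, B₁ and C₁. -/
namespace Subgroup

variable {G : Type*} [Group G] {H : Subgroup G}

theorem mul_inv_mem_symm_s6 {x y : G} (hxy : x * y⁻¹ ∈ H) : y * x⁻¹ ∈ H := by
  simpa using H.inv_mem hxy

theorem mul_inv_mem_trans_s6 {x y z : G} (hxy : x * y⁻¹ ∈ H) (hyz : y * z⁻¹ ∈ H) :
    x * z⁻¹ ∈ H := by
  simpa [mul_assoc] using H.mul_mem hxy hyz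

theorem mul_inv_mem_of_conj_s6 {f x y x' y' : G} (hf : f ∈ H) (hx : f * x * f⁻¹ = x')
    (hy : f * y * f⁻¹ = y') (hxy : x * y⁻¹ ∈ H) : x' * y'⁻¹ ∈ H := by
  subst hx hy
  simpa [mul_assoc] using H.mul_mem (H.mul_mem hf hxy) (H.inv_mem hf)

theorem mem_of_mul_inv_mem {x t : G} (hxt : x * t⁻¹ ∈ H) (ht : t ∈ H) : x ∈ H := by
  simpa using H.mul_mem hxt ht

/-- If `t * x * y * z = u * v * w`, where all factors lie in the same right coset of `H` as `t`
and commute suitably with `t`, then `t ∈ H`. -/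
theorem mem_of_lantern {t x y z u v w : G} (hy : Commute t y) (hz : Commute t z)
    (hv : Commute t v) (hw : Commute t w) (hx' : x * t⁻¹ ∈ H) (hy' : y * t⁻¹ ∈ H)
    (hz' : z * t⁻¹ ∈ H) (hu' : u * t⁻¹ ∈ H) (hv' : v * t⁻¹ ∈ H) (hw' : w * t⁻¹ ∈ H)
    (hrel : t * x * y * z = u * v * w) : t ∈ H := by
  have key (a : G) {b c : G} (hb : Commute t b) (hc : Commute t c) :
      a * t⁻¹ * (b * t⁻¹) * (c * t⁻¹) = a * b * c * (t⁻¹ * t⁻¹ * t⁻¹) := by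
    simp only [mul_assoc, hb.inv_left.left_comm, hc.inv_left.left_comm]
  have hmem := H.mul_mem (H.mul_mem (H.mul_mem hu' hv') hw')
    (H.inv_mem (H.mul_mem (H.mul_mem hx' hy') hz'))
  rw [key u hv hw, key x hy hz, ← hrel] at hmem
  convert hmem using 1
  group

end Subgroup

/-- Abstract group-theoretic core of Lemma 3 of the paper: upgrading differences of
Dehn twists to single Dehn twists via the lantern relation. -/
theorem lemma3_abstract {G : Type*} [Group G]
    (h A₁ A₂ A₃ B₁ B₂ B₃ C₁ C₂ D₁ D₂ g₁ g₂ g₃ g₄ : G)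
    (hg₁ : g₁ = (A₁ * A₂⁻¹) * (B₁ * B₂⁻¹))
    (hg₂ : g₂ = (B₁ * B₂⁻¹) * (C₁ * C₂⁻¹))
    (hg₃ : g₃ = (B₂ * A₁⁻¹) * (C₁ * A₁⁻¹) * (A₁ * A₂⁻¹) * (C₂ * A₁⁻¹))
    (hg₄ : g₄ = (B₃ * A₁⁻¹) * (C₂ * A₁⁻¹) * (A₃ * A₁⁻¹) * (B₃ * A₁⁻¹))
    (hhA₁ : h * A₁ * h⁻¹ = A₂)
    (hhA₂ : h * A₂ * h⁻¹ = A₃)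
    (hhB₁ : h * B₁ * h⁻¹ = B₂)
    (hhB₂ : h * B₂ * h⁻¹ = B₃)
    (hg₁A₁ : g₁ * A₁ * g₁⁻¹ = B₁)
    (hg₁A₃ : g₁ * A₃ * g₁⁻¹ = A₃)
    (hg₂B₁ : g₂ * B₁ * g₂⁻¹ = C₁)
    (hg₂A₃ : g₂ * A₃ * g₂⁻¹ = A₃)
    (hg₃B₂ : g₃ * B₂ * g₃⁻¹ = D₁)
    (hg₃A₁ : g₃ * A₁ * g₃⁻¹ = A₁)
    (hg₄D₁ : g₄ * D₁ * g₄⁻¹ = D₂)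
    (hg₄A₁ : g₄ * A₁ * g₄⁻¹ = A₁)
    (hcomm₁ : ∀ x ∈ ({A₁, C₁, C₂, A₃} : Set G), ∀ y ∈ ({A₂, D₁, D₂} : Set G), Commute x y)
    (hcomm₂ : ∀ x ∈ ({A₁, C₁, C₂, A₃} : Set G), ∀ y ∈ ({A₁, C₁, C₂, A₃} : Set G), Commute x y)
    (hlantern : A₁ * C₁ * C₂ * A₃ = A₂ * D₁ * D₂) :
    A₁ ∈ Subgroup.closure ({h, A₁ * A₂⁻¹, B₁ * B₂⁻¹, C₁ * C₂⁻¹} : Set G) ∧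
    A₂ ∈ Subgroup.closure ({h, A₁ * A₂⁻¹, B₁ * B₂⁻¹, C₁ * C₂⁻¹} : Set G) ∧
    A₃ ∈ Subgroup.closure ({h, A₁ * A₂⁻¹, B₁ * B₂⁻¹, C₁ * C₂⁻¹} : Set G) ∧
    B₁ ∈ Subgroup.closure ({h, A₁ * A₂⁻¹, B₁ * B₂⁻¹, C₁ * C₂⁻¹} : Set G) ∧
    C₁ ∈ Subgroup.closure ({h, A₁ * A₂⁻¹, B₁ * B₂⁻¹, C₁ * C₂⁻¹} : Set G) := by
  set H := Subgroup.closure ({h, A₁ * A₂⁻¹, B₁ * B₂⁻¹, C₁ * C₂⁻¹} : Set G)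
  have hh : h ∈ H := Subgroup.subset_closure (by simp)
  have hA : A₁ * A₂⁻¹ ∈ H := Subgroup.subset_closure (by simp)
  have hB : B₁ * B₂⁻¹ ∈ H := Subgroup.subset_closure (by simp)
  have hC : C₁ * C₂⁻¹ ∈ H := Subgroup.subset_closure (by simp)
  have hA₂A₁ := Subgroup.mul_inv_mem_symm_s6 hA
  have hA₁A₃ := Subgroup.mul_inv_mem_trans_s6 hA (Subgroup.mul_inv_mem_of_conj_s6 hh hhA₁ hhA₂ hA)
  have hA₃A₁ := Subgroup.mul_inv_mem_symm_s6 hA₁A₃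
  have hg₁H : g₁ ∈ H := hg₁ ▸ H.mul_mem hA hB
  have hg₂H : g₂ ∈ H := hg₂ ▸ H.mul_mem hB hC
  have hB₁A₃ := Subgroup.mul_inv_mem_of_conj_s6 hg₁H hg₁A₁ hg₁A₃ hA₁A₃
  have hC₁A₃ := Subgroup.mul_inv_mem_of_conj_s6 hg₂H hg₂B₁ hg₂A₃ hB₁A₃
  have hB₁A₁ := Subgroup.mul_inv_mem_trans_s6 hB₁A₃ hA₃A₁
  have hC₁A₁ := Subgroup.mul_inv_mem_trans_s6 hC₁A₃ hA₃A₁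
  have hC₂A₁ := Subgroup.mul_inv_mem_trans_s6 (Subgroup.mul_inv_mem_symm_s6 hC) hC₁A₁
  have hB₂A₁ := Subgroup.mul_inv_mem_trans_s6 (Subgroup.mul_inv_mem_symm_s6 hB) hB₁A₁
  have hB₃A₁ := Subgroup.mul_inv_mem_trans_s6
    (Subgroup.mul_inv_mem_symm_s6 (Subgroup.mul_inv_mem_of_conj_s6 hh hhB₁ hhB₂ hB)) hB₂A₁
  have hg₃H : g₃ ∈ H := hg₃ ▸ H.mul_mem (H.mul_mem (H.mul_mem hB₂A₁ hC₁A₁) hA) hC₂A₁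
  have hg₄H : g₄ ∈ H := hg₄ ▸ H.mul_mem (H.mul_mem (H.mul_mem hB₃A₁ hC₂A₁) hA₃A₁) hB₃A₁
  have hD₁A₁ := Subgroup.mul_inv_mem_of_conj_s6 hg₃H hg₃B₂ hg₃A₁ hB₂A₁
  have hD₂A₁ := Subgroup.mul_inv_mem_of_conj_s6 hg₄H hg₄D₁ hg₄A₁ hD₁A₁
  have hA₁ : A₁ ∈ H := Subgroup.mem_of_lantern
    (hcomm₂ A₁ (by simp) C₂ (by simp)) (hcomm₂ A₁ (by simp) A₃ (by simp))
    (hcomm₁ A₁ (by simp) D₁ (by simp)) (hcomm₁ A₁ (by simp) D₂ (by simp))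
    hC₁A₁ hC₂A₁ hA₃A₁ hA₂A₁ hD₁A₁ hD₂A₁ hlantern
  exact ⟨hA₁, Subgroup.mem_of_mul_inv_mem hA₂A₁ hA₁, Subgroup.mem_of_mul_inv_mem hA₃A₁ hA₁,
    Subgroup.mem_of_mul_inv_mem hB₁A₁ hA₁, Subgroup.mem_of_mul_inv_mem hC₁A₁ hA₁⟩
end

section
/- Let n be a positive integer, G a group, and a, a′, b, c : ZMod n → G families of elements of G, together with elements ρ, R ∈ G, satisfying for every i ∈ ZMod n: Ra(i)R⁻¹ = a(i+1), Ra′(i)R⁻¹ = a′(i+1), Rb(i)R⁻¹ = b(i+1), Rc(i)R⁻¹ = c(i+1), and also ρb(1)ρ⁻¹ = b(1) and ρc(1)ρ⁻¹ = c(0). Define F₁ = a(1)c(1)b(3)b(5)⁻¹c(6)⁻¹a′(7)⁻¹, F₂ = RF₁R⁻¹, F₃ = (F₂F₁)F₂(F₂F₁)⁻¹, F₄ = R⁻¹F₃R, F₆ = (a(3)b(3)⁻¹)F₁ and F₇ = RF₆R⁻¹. Assume the conjugation relations: conjugation by F₂F₁ fixes a(2), b(4), c(7), a′(8) and sends c(2)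 to b(3) and b(6) to c(6); conjugation by F₄F₃ fixes a(1), b(3), c(5), c(6), a′(7) and sends b(2) to a(2); conjugation by F₇F₆ fixes a(2), c(2), a(4), c(7), a′(8) and sends b(6) to c(6). Assume moreover that a(1) commutes with a(2) and with b(2), that a(3) and b(3) each commute with a(1) and with c(1), and that b(6) and c(6) each commute with c(7) and with a′(8). Then the subgroup of G generated by ρ, R and F₁ contains the elements a(1)a(2)⁻¹, b(1)b(2)⁻¹ and c(1)c(2)⁻¹. -/
/-- If conjugation by an element `R` of a subgroup `H` shifts the indices of a family over `ZMod n`,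
then `H` contains the whole family as soon as it contains one member. -/
theorem Subgroup.forall_mem_of_conj_shift {G : Type*} [Group G] {n : ℕ} [NeZero n]
    {H : Subgroup G} {R : G} (hR : R ∈ H) {f : ZMod n → G}
    (hf : ∀ i, R * f i * R⁻¹ = f (i + 1)) {i : ZMod n} (hi : f i ∈ H) (j : ZMod n) :
    f j ∈ H := by
  have key : ∀ k : ℕ, f (i + k) ∈ H := by
    intro k
    induction k with
    | zero => simpa using hi
    | succ k ih =>
      rw [Nat.cast_succ, ← add_assoc, ← hf]
      exact H.mul_mem (H.mul_mem hR ih) (H.inv_mem hR)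
  obtain ⟨k, hk⟩ := ZMod.natCast_zmod_surjective (j - i)
  simpa [hk] using key k

/-- Abstract group-theoretic core of Lemma 4 of the paper (the case `n ≥ 7`). -/
theorem lemma4_abstract {G : Type*} [Group G] (n : ℕ) (hn : 0 < n)
    (a a' b c : ZMod n → G) (ρ R : G)
    (hRa : ∀ i, R * a i * R⁻¹ = a (i + 1))
    (hRa' : ∀ i, R * a' i * R⁻¹ = a' (i + 1))
    (hRb : ∀ i, R * b i * R⁻¹ = b (i + 1))
    (hRc : ∀ i, R * c i * R⁻¹ = c (i + 1))
    (hρb : ρ * b 1 * ρ⁻¹ = b 1)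
    (hρc : ρ * c 1 * ρ⁻¹ = c 0)
    (F₁ F₂ F₃ F₄ F₆ F₇ : G)
    (hF₁ : F₁ = a 1 * c 1 * b 3 * (b 5)⁻¹ * (c 6)⁻¹ * (a' 7)⁻¹)
    (hF₂ : F₂ = R * F₁ * R⁻¹)
    (hF₃ : F₃ = (F₂ * F₁) * F₂ * (F₂ * F₁)⁻¹)
    (hF₄ : F₄ = R⁻¹ * F₃ * R)
    (hF₆ : F₆ = (a 3 * (b 3)⁻¹) * F₁)
    (hF₇ : F₇ = R * F₆ * R⁻¹)
    (h21a : (F₂ * F₁) * a 2 * (F₂ * F₁)⁻¹ = a 2)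
    (h21b : (F₂ * F₁) * b 4 * (F₂ * F₁)⁻¹ = b 4)
    (h21c : (F₂ * F₁) * c 7 * (F₂ * F₁)⁻¹ = c 7)
    (h21a' : (F₂ * F₁) * a' 8 * (F₂ * F₁)⁻¹ = a' 8)
    (h21cb : (F₂ * F₁) * c 2 * (F₂ * F₁)⁻¹ = b 3)
    (h21bc : (F₂ * F₁) * b 6 * (F₂ * F₁)⁻¹ = c 6)
    (h43a : (F₄ * F₃) * a 1 * (F₄ * F₃)⁻¹ = a 1)
    (h43b : (F₄ * F₃) * b 3 * (F₄ * F₃)⁻¹ = b 3)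
    (h43c5 : (F₄ * F₃) * c 5 * (F₄ * F₃)⁻¹ = c 5)
    (h43c6 : (F₄ * F₃) * c 6 * (F₄ * F₃)⁻¹ = c 6)
    (h43a' : (F₄ * F₃) * a' 7 * (F₄ * F₃)⁻¹ = a' 7)
    (h43ba : (F₄ * F₃) * b 2 * (F₄ * F₃)⁻¹ = a 2)
    (h76a2 : (F₇ * F₆) * a 2 * (F₇ * F₆)⁻¹ = a 2)
    (h76c2 : (F₇ * F₆) * c 2 * (F₇ * F₆)⁻¹ = c 2)
    (h76a4 : (F₇ * F₆) * a 4 * (F₇ * F₆)⁻¹ = a 4)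
    (h76c7 : (F₇ * F₆) * c 7 * (F₇ * F₆)⁻¹ = c 7)
    (h76a' : (F₇ * F₆) * a' 8 * (F₇ * F₆)⁻¹ = a' 8)
    (h76bc : (F₇ * F₆) * b 6 * (F₇ * F₆)⁻¹ = c 6)
    (hc₁ : Commute (a 1) (a 2)) (hc₂ : Commute (a 1) (b 2))
    (hc₃ : Commute (a 3) (a 1)) (hc₄ : Commute (a 3) (c 1))
    (hc₅ : Commute (b 3) (a 1)) (hc₆ : Commute (b 3) (c 1))
    (hc₇ : Commute (b 6) (c 7)) (hc₈ : Commute (b 6) (a' 8))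
    (hc₉ : Commute (c 6) (c 7)) (hc₁₀ : Commute (c 6) (a' 8)) :
    a 1 * (a 2)⁻¹ ∈ Subgroup.closure ({ρ, R, F₁} : Set G) ∧
    b 1 * (b 2)⁻¹ ∈ Subgroup.closure ({ρ, R, F₁} : Set G) ∧
    c 1 * (c 2)⁻¹ ∈ Subgroup.closure ({ρ, R, F₁} : Set G) := by
  have : NeZero n := ⟨hn.ne'⟩
  set H := Subgroup.closure ({ρ, R, F₁} : Set G)
  have mρ : ρ ∈ H := Subgroup.subset_closure (by simp)
  have mR : R ∈ H := Subgroup.subset_closure (by simp)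
  have mF₁ : F₁ ∈ H := Subgroup.subset_closure (by simp)
  have conj_mem : ∀ {g x : G}, g ∈ H → x ∈ H → MulAut.conj g x ∈ H := fun hg hx =>
    H.mul_mem (H.mul_mem hg hx) (H.inv_mem hg)
  have shift : ∀ {p q : ZMod n → G}, (∀ i, R * p i * R⁻¹ = p (i + 1)) →
      (∀ i, R * q i * R⁻¹ = q (i + 1)) → ∀ i, R * (p i * (q i)⁻¹) * R⁻¹ =
        p (i + 1) * (q (i + 1))⁻¹ := by
    intro p q hp hq i
    rw [← hp, ← hq]
    group
  have e2 : (1 : ZMod n) + 1 = 2 := by norm_num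
  have e3 : (2 : ZMod n) + 1 = 3 := by norm_num
  have e4 : (3 : ZMod n) + 1 = 4 := by norm_num
  have e6 : (5 : ZMod n) + 1 = 6 := by norm_num
  have e7 : (6 : ZMod n) + 1 = 7 := by norm_num
  have e8 : (7 : ZMod n) + 1 = 8 := by norm_num
  simp only [← MulAut.conj_apply] at hRa hRa' hRb hRc hF₂ hF₃ hF₇ h21a h21b h21c h21a' h21cb h21bc
  simp only [← MulAut.conj_apply] at h43a h43b h43c5 h43c6 h43a' h43ba h76a2 h76c2 h76a4 h76c7 h76a' h76bc
  have mF₂ : F₂ ∈ H := hF₂ ▸ conj_mem mR mF₁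
  have mF₃ : F₃ ∈ H := hF₃ ▸ conj_mem (H.mul_mem mF₂ mF₁) mF₂
  have mF₄ : F₄ ∈ H := hF₄ ▸ H.mul_mem (H.mul_mem (H.inv_mem mR) mF₃) mR
  have F₂_eq : F₂ = a 2 * c 2 * b 4 * (b 6)⁻¹ * (c 7)⁻¹ * (a' 8)⁻¹ := by
    rw [hF₂, hF₁]
    simp only [map_mul, map_inv, hRa, hRa', hRb, hRc, e2, e4, e6, e7, e8]
  have F₃_eq : F₃ = a 2 * b 3 * b 4 * (c 6)⁻¹ * (c 7)⁻¹ * (a' 8)⁻¹ := by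
    have h := congrArg (MulAut.conj (F₂ * F₁)) F₂_eq
    rw [← hF₃] at h
    simpa only [map_mul _ (_ * _), map_mul _ (a 2), map_inv, h21a, h21b, h21c, h21a', h21cb,
      h21bc] using h
  have F₄_eq : F₄ = a 1 * b 2 * b 3 * (c 5)⁻¹ * (c 6)⁻¹ * (a' 7)⁻¹ := by
    apply (MulAut.conj R).injective
    simp only [map_mul (MulAut.conj R), map_inv (MulAut.conj R), hRa, hRa', hRb, hRc, e2, e3, e4,
      e6, e7, e8]
    rw [← F₃_eq, hF₄]
    simp [MulAut.conj_apply, mul_assoc]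
  have mab : a 2 * (b 2)⁻¹ ∈ H := by
    have h : MulAut.conj (F₄ * F₃) F₄ * F₄⁻¹ ∈ H :=
      H.mul_mem (conj_mem (H.mul_mem mF₄ mF₃) mF₄) (H.inv_mem mF₄)
    generalize MulAut.conj (F₄ * F₃) = φ at *
    rw [F₄_eq] at h
    simp only [map_mul, map_inv, h43a, h43b, h43c5, h43c6, h43a', h43ba] at h
    convert h using 1
    calc a 2 * (b 2)⁻¹ = a 1 * (a 2 * (b 2)⁻¹) * (a 1)⁻¹ := by
          rw [(hc₁.mul_right hc₂.inv_right).eq, mul_inv_cancel_right]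
      _ = _ := by group
  have hab := Subgroup.forall_mem_of_conj_shift mR (shift hRa hRb) mab
  have mF₆ : F₆ ∈ H := hF₆ ▸ H.mul_mem (hab 3) mF₁
  have mF₇ : F₇ ∈ H := hF₇ ▸ conj_mem mR mF₆
  have F₆_eq : F₆ = a 1 * c 1 * a 3 * (b 5)⁻¹ * (c 6)⁻¹ * (a' 7)⁻¹ := by
    have h : Commute (a 3 * (b 3)⁻¹) (a 1 * c 1) :=
      (hc₃.mul_right hc₄).mul_left (hc₅.mul_right hc₆).inv_left
    calc F₆ = a 3 * (b 3)⁻¹ * (a 1 * c 1) * (b 3 * (b 5)⁻¹ * (c 6)⁻¹ * (a' 7)⁻¹) := by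
          rw [hF₆, hF₁]; group
      _ = _ := by rw [h.eq]; group
  have F₇_eq : F₇ = a 2 * c 2 * a 4 * (b 6)⁻¹ * (c 7)⁻¹ * (a' 8)⁻¹ := by
    rw [hF₇, F₆_eq]
    simp only [map_mul, map_inv, hRa, hRa', hRb, hRc, e2, e4, e6, e7, e8]
  have mbc : b 6 * (c 6)⁻¹ ∈ H := by
    have h : F₇⁻¹ * MulAut.conj (F₇ * F₆) F₇ ∈ H :=
      H.mul_mem (H.inv_mem mF₇) (conj_mem (H.mul_mem mF₇ mF₆) mF₇)
    generalize MulAut.conj (F₇ * F₆) = φ at *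
    rw [F₇_eq] at h
    simp only [map_mul, map_inv, h76a2, h76c2, h76a4, h76c7, h76a', h76bc] at h
    have hcomm : Commute (b 6 * (c 6)⁻¹) ((c 7)⁻¹ * (a' 8)⁻¹) :=
      (hc₇.inv_right.mul_right hc₈.inv_right).mul_left
        (hc₉.inv_right.mul_right hc₁₀.inv_right).inv_left
    convert h using 1
    calc b 6 * (c 6)⁻¹ = ((c 7)⁻¹ * (a' 8)⁻¹)⁻¹ * (b 6 * (c 6)⁻¹ * ((c 7)⁻¹ * (a' 8)⁻¹)) := by
          rw [hcomm.eq, inv_mul_cancel_left]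
      _ = _ := by group
  have hbc := Subgroup.forall_mem_of_conj_shift mR (shift hRb hRc) mbc
  have mc : c 0 * (c (0 + 1))⁻¹ ∈ H := by
    have h : b 1 * (c 0)⁻¹ ∈ H := by
      have h := conj_mem mρ (hbc 1)
      rwa [map_mul, map_inv, MulAut.conj_apply, MulAut.conj_apply, hρb, hρc] at h
    have h' := H.mul_mem (H.inv_mem h) (hbc 1)
    rw [zero_add]
    convert h' using 1
    group
  have hc : c 1 * (c 2)⁻¹ ∈ H := by
    have h := Subgroup.forall_mem_of_conj_shift mR
      (shift hRc (q := fun i => c (i + 1)) fun i => hRc (i + 1)) mc 1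
    rwa [e2] at h
  have hb : b 1 * (b 2)⁻¹ ∈ H := by
    convert H.mul_mem (H.mul_mem (hbc 1) hc) (H.inv_mem (hbc 2)) using 1
    group
  refine ⟨?_, hb, hc⟩
  convert H.mul_mem (H.mul_mem (hab 1) hb) (H.inv_mem (hab 2)) using 1
  group
end
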